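/- Let h ≥ 1, Δ > 0, and let P = P₀ \ ⋃_{i=1}^h interior(Pᵢ) be a polygonal domain in 𝒞(h) in which every hole satisfies diam₂(Pᵢ) ≤ Δ·diam₂(P). Then for every point s ∈ P there exists a continuous path γ : [0,1] → ℝ² with γ(0) = s, γ(1) ∈ frontier(P₀), image of γ contained in P, and length at most (1 + π·h·Δ)·diam₂(P). In particular, when Δ ≤ 1/h this length is at most (1 + π)·diam₂(P). -/

import Mathlib

open Set Metric ENNReal RealInnerProductSpace

noncomputable section

/-- The Euclidean plane. -/
abbrev Plane := EuclideanSpace ℝ (Fin 2)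

/-- A convex polygon: the convex hull of a nonempty finite point set. -/
def IsConvexPolygon (Q : Set Plane) : Prop :=
  ∃ S : Finset Plane, S.Nonempty ∧ Q = convexHull ℝ (S : Set Plane)

/-- `γ` is a continuous path from `s` to `t` (parametrized on `[0,1]`) with image in `P`. -/
def IsPathIn (P : Set Plane) (γ : ℝ → Plane) (s t : Plane) : Prop :=
  ContinuousOn γ (Set.Icc 0 1) ∧ γ 0 = s ∧ γ 1 = t ∧ Set.MapsTo γ (Set.Icc 0 1) P

/-- Length of a path: its total variation on `[0,1]`. -/
def pathLen (γ : ℝ → Plane) : ℝ≥0∞ := eVariationOn γ (Set.Icc 0 1)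

/-- Geodesic distance inside `P`: infimum of lengths of continuous paths
from `s` to `t` contained in `P`. -/
def geod (P : Set Plane) (s t : Plane) : ℝ≥0∞ :=
  ⨅ γ : {γ : ℝ → Plane // IsPathIn P γ s t}, pathLen γ.1

/-- Geodesic diameter of `P`. -/
def geodDiam (P : Set Plane) : ℝ≥0∞ :=
  ⨆ s ∈ P, ⨆ t ∈ P, geod P s t

/-- The width of a planar set: the minimum, over unit directions `v`,
of the extent of `C` in direction `v`. -/
def setWidth (C : Set Plane) : ℝ :=
  ⨅ v : {v : Plane // ‖v‖ = 1},
    (sSup ((fun x => ⟪x, v.1⟫) '' C) - sInf ((fun x => ⟪x, v.1⟫) '' C))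

section Reachability

variable {E : Type*} [NormedAddCommGroup E]

/-- `x` and `y` are joined by a continuous path inside `S` of length at most `L`. -/
def JoinedWithin (S : Set E) (x y : E) (L : ℝ≥0∞) : Prop :=
  ∃ γ : ℝ → E, ContinuousOn γ (Icc 0 1) ∧ γ 0 = x ∧ γ 1 = y ∧ MapsTo γ (Icc 0 1) S ∧
    eVariationOn γ (Icc 0 1) ≤ L

namespace JoinedWithin

variable {S T : Set E} {x y z : E} {L M : ℝ≥0∞}

theorem mono (h : JoinedWithin S x y L) (hST : S ⊆ T) (hLM : L ≤ M) : JoinedWithin T x y M := by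
  obtain ⟨γ, hc, h0, h1, hS, hL⟩ := h
  exact ⟨γ, hc, h0, h1, fun t ht => hST (hS ht), hL.trans hLM⟩

theorem of_Icc {γ : ℝ → E} {a b : ℝ} (hab : a ≤ b) (hc : ContinuousOn γ (Icc a b))
    (hS : MapsTo γ (Icc a b) S) :
    JoinedWithin S (γ a) (γ b) (eVariationOn γ (Icc a b)) := by
  have hmono : MonotoneOn (fun t : ℝ => a + t * (b - a)) (Icc 0 1) := fun s _ t _ hst => by
    have := mul_le_mul_of_nonneg_right hst (sub_nonneg.2 hab)
    simpa using this
  have hmaps : MapsTo (fun t : ℝ => a + t * (b - a)) (Icc 0 1) (Icc a b) := fun t ht =>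
    ⟨by nlinarith [ht.1, ht.2], by nlinarith [ht.1, ht.2]⟩
  exact ⟨γ ∘ fun t => a + t * (b - a), hc.comp (by fun_prop) hmaps, by simp, by simp,
    hS.comp hmaps, eVariationOn.comp_le_of_monotoneOn γ _ hmono hmaps⟩

theorem trans (h₁ : JoinedWithin S x y L) (h₂ : JoinedWithin S y z M) :
    JoinedWithin S x z (L + M) := by
  obtain ⟨γ, hγc, hγ0, hγ1, hγS, hγL⟩ := h₁
  obtain ⟨δ, hδc, hδ0, hδ1, hδS, hδM⟩ := h₂
  set φ : ℝ → E := fun t => if t ≤ 1 then γ t else δ (t - 1) with hφ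
  have hmaps : MapsTo (fun t : ℝ => t - 1) (Icc 1 2) (Icc 0 1) := fun t ht =>
    ⟨by linarith [ht.1], by linarith [ht.2]⟩
  have hleft : EqOn φ γ (Icc 0 1) := fun t ht => by simp [hφ, ht.2]
  have hright : EqOn φ (δ ∘ fun t => t - 1) (Icc 1 2) := fun t ht => by
    rcases ht.1.eq_or_lt with rfl | hlt
    · simp [hφ, hγ1, hδ0]
    · simp [hφ, not_le.2 hlt]
  have hunion : (Icc 0 1 ∪ Icc 1 2 : Set ℝ) = Icc 0 2 :=
    Icc_union_Icc_eq_Icc zero_le_one one_le_two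
  have hc : ContinuousOn φ (Icc 0 2) := by
    rw [← hunion]
    exact (hγc.congr hleft).union_of_isClosed
      ((hδc.comp (by fun_prop) hmaps).congr hright) isClosed_Icc isClosed_Icc
  have hS : MapsTo φ (Icc 0 2) S := by
    rw [← hunion]
    exact (hγS.congr hleft.symm).union ((hδS.comp hmaps).congr hright.symm)
  have hvar : eVariationOn φ (Icc 0 2) ≤ L + M := by
    have := eVariationOn.Icc_add_Icc φ (s := univ) zero_le_one one_le_two (mem_univ (1 : ℝ))
    simp only [univ_inter] at this
    rw [← this, eVariationOn.eq_of_eqOn hleft, eVariationOn.eq_of_eqOn hright]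
    refine add_le_add hγL (le_trans ?_ hδM)
    exact eVariationOn.comp_le_of_monotoneOn δ _ (fun s _ t _ hst => sub_le_sub_right hst 1) hmaps
  have hend : φ 2 = z := by
    rw [hright ⟨one_le_two, le_rfl⟩]
    norm_num [hδ1]
  have hstart : φ 0 = x := by rw [hleft ⟨le_rfl, zero_le_one⟩, hγ0]
  rw [← hend, ← hstart]
  exact (of_Icc zero_le_two hc hS).mono subset_rfl hvar

theorem of_segment [NormedSpace ℝ E] (h : segment ℝ x y ⊆ S) :
    JoinedWithin S x y (ENNReal.ofReal (dist x y)) := by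
  refine ⟨AffineMap.lineMap x y, AffineMap.lineMap_continuous.continuousOn, by simp, by simp,
    fun t ht => h ?_, ?_⟩
  · rw [segment_eq_image_lineMap]
    exact mem_image_of_mem _ ht
  · have hid : eVariationOn (id : ℝ → ℝ) (Icc 0 1) ≤ 1 := by
      have := (monotone_id.monotoneOn univ).eVariationOn_eq (mem_univ (0 : ℝ)) (mem_univ 1)
      simp only [univ_inter] at this
      simp [this]
    calc eVariationOn (AffineMap.lineMap x y ∘ id) (Icc (0 : ℝ) 1)
        ≤ (nndist x y : ℝ≥0∞) * eVariationOn (id : ℝ → ℝ) (Icc 0 1) :=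
          ((lipschitzWith_lineMap x y).lipschitzOnWith (s := univ)).comp_eVariationOn_le
            (mapsTo_univ _ _)
      _ ≤ (nndist x y : ℝ≥0∞) * 1 := by gcongr
      _ = ENNReal.ofReal (dist x y) := by rw [mul_one, ← edist_nndist, edist_dist]

theorem map {f : E → E} (hf : LipschitzWith 1 f) (hST : MapsTo f S T)
    (h : JoinedWithin S x y L) : JoinedWithin T (f x) (f y) L := by
  obtain ⟨γ, hc, rfl, rfl, hS, hL⟩ := h
  refine ⟨f ∘ γ, hf.continuous.comp_continuousOn hc, rfl, rfl, hST.comp hS, ?_⟩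
  have := (hf.lipschitzOnWith (s := univ)).comp_eVariationOn_le (mapsTo_univ γ (Icc 0 1))
  exact this.trans (by simpa using hL)

/-- A path can be rerouted around the interior of a closed set along its frontier. -/
theorem avoid_interior {Q : Set E} (hQ : IsClosed Q) (hx : x ∉ interior Q) (hy : y ∉ interior Q)
    (hdetour : ∀ a ∈ Q \ interior Q, ∀ b ∈ Q \ interior Q, JoinedWithin (Q \ interior Q) a b M)
    (h : JoinedWithin S x y L) :
    JoinedWithin (S \ interior Q ∪ Q \ interior Q) x y (L + M) := by
  obtain ⟨γ, hc, rfl, rfl, hS, hL⟩ := h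
  by_cases hne : (Icc 0 1 ∩ γ ⁻¹' Q).Nonempty
  swap
  · refine ⟨γ, hc, rfl, rfl, fun t ht => Or.inl ⟨hS ht, fun hi => hne ?_⟩, hL.trans le_self_add⟩
    exact ⟨t, ht, (interior_subset hi : γ t ∈ Q)⟩
  have hK : IsCompact (Icc 0 1 ∩ γ ⁻¹' Q) :=
    isCompact_Icc.of_isClosed_subset (hc.preimage_isClosed_of_isClosed isClosed_Icc hQ)
      inter_subset_left
  obtain ⟨a, ⟨ha, haQ⟩, hmin⟩ := hK.exists_isLeast hne
  obtain ⟨b, ⟨hb, hbQ⟩, hmax⟩ := hK.exists_isGreatest hne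
  have hab : a ≤ b := hmin ⟨hb, hbQ⟩
  have hbefore : ∀ t ∈ Ico 0 a, γ t ∈ Qᶜ := fun t ht htQ =>
    ht.2.not_ge (hmin ⟨⟨ht.1, ht.2.le.trans ha.2⟩, htQ⟩)
  have hafter : ∀ t ∈ Ioc b 1, γ t ∈ Qᶜ := fun t ht htQ =>
    ht.1.not_ge (hmax ⟨⟨hb.1.trans ht.1.le, ht.2⟩, htQ⟩)
  have hca : ContinuousOn γ (Icc 0 a) := hc.mono (Icc_subset_Icc_right ha.2)
  have hcb : ContinuousOn γ (Icc b 1) := hc.mono (Icc_subset_Icc_left hb.1)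
  have hleft : MapsTo γ (Icc 0 a) (interior Q)ᶜ := by
    rcases ha.1.eq_or_lt with rfl | hlt
    · intro t ht
      rwa [le_antisymm ht.2 ht.1]
    · have := MapsTo.closure_of_continuousOn hbefore (by rwa [closure_Ico hlt.ne])
      rwa [closure_Ico hlt.ne, closure_compl] at this
  have hright : MapsTo γ (Icc b 1) (interior Q)ᶜ := by
    rcases hb.2.eq_or_lt with rfl | hlt
    · intro t ht
      rwa [le_antisymm ht.2 ht.1]
    · have := MapsTo.closure_of_continuousOn hafter (by rwa [closure_Ioc hlt.ne])
      rwa [closure_Ioc hlt.ne, closure_compl] at this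
  have h₁ : JoinedWithin (S \ interior Q ∪ Q \ interior Q) (γ 0) (γ a) _ :=
    of_Icc ha.1 hca fun t ht => Or.inl ⟨hS ⟨ht.1, ht.2.trans ha.2⟩, hleft ht⟩
  have h₂ := (hdetour (γ a) ⟨haQ, hleft ⟨ha.1, le_rfl⟩⟩ (γ b) ⟨hbQ, hright ⟨le_rfl, hb.2⟩⟩).mono
    (T := S \ interior Q ∪ Q \ interior Q) subset_union_right le_rfl
  have h₃ : JoinedWithin (S \ interior Q ∪ Q \ interior Q) (γ b) (γ 1) _ :=
    of_Icc hb.2 hcb fun t ht => Or.inl ⟨hS ⟨hb.1.trans ht.1, ht.2⟩, hright ht⟩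
  refine ((h₁.trans h₂).trans h₃).mono subset_rfl ?_
  calc eVariationOn γ (Icc 0 a) + M + eVariationOn γ (Icc b 1)
      = eVariationOn γ (Icc 0 a) + eVariationOn γ (Icc b 1) + M := by ring
    _ ≤ eVariationOn γ (Icc 0 1) + M := by
        gcongr
        refine (eVariationOn.add_le_union γ fun s hs t ht =>
          hs.2.trans (hab.trans ht.1)).trans (eVariationOn.mono γ ?_)
        exact union_subset (Icc_subset_Icc_right ha.2) (Icc_subset_Icc_left hb.1)
    _ ≤ L + M := by gcongr

end JoinedWithin

end Reachability

section ConvexGeometry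

variable {E : Type*} [NormedAddCommGroup E] [InnerProductSpace ℝ E]

/-- The nearest-point projection onto a compact convex set. -/
theorem exists_lipschitz_projection {Q : Set E} (hQ : Convex ℝ Q) (hcomp : IsCompact Q)
    (hne : Q.Nonempty) :
    ∃ f : E → E, LipschitzWith 1 f ∧ (∀ x ∈ Q, f x = x) ∧
      MapsTo f (interior Q)ᶜ (Q \ interior Q) := by
  choose f hfQ hfmin using exists_norm_eq_iInf_of_complete_convex hne hcomp.isComplete hQ
  have hf : ∀ x, ∀ w ∈ Q, ⟪x - f x, w - f x⟫ ≤ 0 := fun x =>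
    (norm_eq_iInf_iff_real_inner_le_zero hQ (hfQ x)).1 (hfmin x)
  have hfix : ∀ x ∈ Q, f x = x := fun x hx => by
    have := hf x x hx
    rw [real_inner_self_nonpos, sub_eq_zero] at this
    exact this.symm
  refine ⟨f, LipschitzWith.of_dist_le_mul fun x y => ?_, hfix, fun x hx => ⟨hfQ x, fun hi => ?_⟩⟩
  · rw [NNReal.coe_one, one_mul, dist_eq_norm, dist_eq_norm]
    have h₁ := hf x (f y) (hfQ y)
    have h₂ := hf y (f x) (hfQ x)
    have h₃ : ⟪f x - f y, f x - f y⟫ ≤ ⟪x - y, f x - f y⟫ := by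
      simp only [inner_sub_left, inner_sub_right] at h₁ h₂ ⊢
      linarith
    rw [real_inner_self_eq_norm_sq] at h₃
    have h₄ := real_inner_le_norm (x - y) (f x - f y)
    by_contra! hlt
    nlinarith [norm_nonneg (x - y), norm_nonneg (f x - f y)]
  · have hlim : Filter.Tendsto (fun t : ℝ => f x + t • (x - f x)) (nhdsWithin 0 (Ioi 0))
        (nhds (f x)) := by
      have hcont : Continuous fun t : ℝ => f x + t • (x - f x) := by fun_prop
      simpa using (hcont.tendsto 0).mono_left nhdsWithin_le_nhds
    obtain ⟨t, htQ, ht⟩ := ((hlim.eventually (mem_interior_iff_mem_nhds.1 hi)).and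
      self_mem_nhdsWithin).exists
    have h₁ := hf x _ htQ
    rw [add_sub_cancel_left, inner_smul_right] at h₁
    have h₂ : ⟪x - f x, x - f x⟫ ≤ 0 := nonpos_of_mul_nonpos_right h₁ ht
    rw [real_inner_self_nonpos, sub_eq_zero] at h₂
    exact hx (h₂ ▸ hi)

theorem segment_subset_compl_interior {Q : Set E} {v x y : E} {K : ℝ} (hv : v ≠ 0)
    (hK : ∀ q ∈ Q, ⟪q, v⟫ ≤ K) (hx : K ≤ ⟪x, v⟫) (hy : K ≤ ⟪y, v⟫) :
    segment ℝ x y ⊆ (interior Q)ᶜ := by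
  rintro z ⟨α, β, hα, hβ, hαβ, rfl⟩ hi
  set z := α • x + β • y with hz
  have hKz : K ≤ ⟪z, v⟫ := by
    rw [hz, inner_add_left, real_inner_smul_left, real_inner_smul_left]
    calc K = α * K + β * K := by rw [← add_mul, hαβ, one_mul]
      _ ≤ α * ⟪x, v⟫ + β * ⟪y, v⟫ := by gcongr
  have hlim : Filter.Tendsto (fun t : ℝ => z + t • v) (nhdsWithin 0 (Ioi 0)) (nhds z) := by
    have hcont : Continuous fun t : ℝ => z + t • v := by fun_prop
    simpa using (hcont.tendsto 0).mono_left nhdsWithin_le_nhds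
  obtain ⟨t, htQ, ht⟩ := ((hlim.eventually (mem_interior_iff_mem_nhds.1 hi)).and
    self_mem_nhdsWithin).exists
  have h₁ := hK _ htQ
  rw [inner_add_left, real_inner_smul_left] at h₁
  linarith [mul_pos (mem_Ioi.1 ht) (real_inner_self_pos.2 hv)]

theorem Convex.segment_ray_subset_compl_interior {Q : Set E} (hQ : Convex ℝ Q) {a b : E}
    (ha : a ∉ interior Q) (hb : b ∈ Q) {t : ℝ} (ht : 0 ≤ t) :
    segment ℝ a (a + t • (a - b)) ⊆ (interior Q)ᶜ := by
  rintro z ⟨α, β, hα, hβ, hαβ, rfl⟩ hi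
  have hs : 0 ≤ β * t := mul_nonneg hβ ht
  refine ha ?_
  have := hQ.combo_interior_closure_mem_interior hi (subset_closure hb)
    (a := 1 / (1 + β * t)) (b := β * t / (1 + β * t)) (by positivity) (by positivity)
    (by field_simp)
  convert this using 1
  obtain rfl : α = 1 - β := by linarith
  have h1 : (1 + β * t) ≠ 0 := by positivity
  match_scalars <;> field_simp <;> ring

/-- Walking around a bounding box of `Q` on the side of the chord `ab` towards `n`. -/
theorem JoinedWithin.around_side {Q : Set E} (hQ : Convex ℝ Q) (hcomp : IsCompact Q) {a b n : E}
    (ha : a ∈ Q \ interior Q) (hb : b ∈ Q \ interior Q) (hab : a ≠ b) (hn : n ≠ 0)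
    (horth : ⟪b - a, n⟫ = 0) {η : ℝ} (hη : ∀ x ∈ Q, ⟪x - a, n⟫ ≤ η * ‖n‖ ^ 2)
    (hηD : 2 * (η * ‖n‖) ≤ diam Q) :
    JoinedWithin (interior Q)ᶜ a b (ENNReal.ofReal (3 * diam Q)) := by
  have hne : Q.Nonempty := ⟨a, ha.1⟩
  have hd : 0 < ‖b - a‖ := norm_pos_iff.2 (sub_ne_zero.2 hab.symm)
  have hn0 : 0 < ‖n‖ := norm_pos_iff.2 hn
  obtain ⟨y, hyQ, hy⟩ := hcomp.exists_isMaxOn hne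
    (f := fun x => ⟪x, a - b⟫) (by fun_prop)
  obtain ⟨z, hzQ, hz⟩ := hcomp.exists_isMaxOn hne
    (f := fun x => ⟪x, b - a⟫) (by fun_prop)
  have hba : ⟪b - a, b - a⟫ = ‖b - a‖ ^ 2 := real_inner_self_eq_norm_sq _
  set τ := ⟪y - a, a - b⟫ / ‖b - a‖ ^ 2 with hτdef
  set σ := ⟪z - b, b - a⟫ / ‖b - a‖ ^ 2 with hσdef
  have hτmul : τ * ‖b - a‖ ^ 2 = ⟪y - a, a - b⟫ := by rw [hτdef]; field_simp
  have hσmul : σ * ‖b - a‖ ^ 2 = ⟪z - b, b - a⟫ := by rw [hσdef]; field_simp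
  have hτ : 0 ≤ τ := div_nonneg (by rw [inner_sub_left, sub_nonneg]; exact hy ha.1) (sq_nonneg _)
  have hσ : 0 ≤ σ := div_nonneg (by rw [inner_sub_left, sub_nonneg]; exact hz hb.1) (sq_nonneg _)
  have hη0 : 0 ≤ η := by
    have := hη a ha.1
    rw [sub_self, inner_zero_left] at this
    exact nonneg_of_mul_nonneg_left this (by positivity)
  have hwidth : (1 + τ + σ) * ‖b - a‖ ≤ diam Q := by
    have h₁ : (1 + τ + σ) * ‖b - a‖ ^ 2 = ⟪z - y, b - a⟫ := by
      rw [add_mul, add_mul, hτmul, hσmul, one_mul, ← hba]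
      simp only [inner_sub_left, inner_sub_right]
      ring
    have h₂ := real_inner_le_norm (z - y) (b - a)
    have h₃ : ‖z - y‖ ≤ diam Q := by
      rw [← dist_eq_norm]
      exact dist_le_diam_of_mem hcomp.isBounded hzQ hyQ
    nlinarith
  set p := a + τ • (a - b) with hp
  set q := b + σ • (b - a) with hq
  have hp_inner : ⟪p, a - b⟫ = ⟪y, a - b⟫ := by
    have h₁ : ⟪a - b, a - b⟫ = ‖b - a‖ ^ 2 := by
      rw [real_inner_self_eq_norm_sq, norm_sub_rev]
    rw [hp, inner_add_left, real_inner_smul_left, h₁, hτmul, inner_sub_left]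
    ring
  have hq_inner : ⟪q, b - a⟫ = ⟪z, b - a⟫ := by
    rw [hq, inner_add_left, real_inner_smul_left, hba, hσmul, inner_sub_left]
    ring
  have horth' : ⟪n, b - a⟫ = 0 := by rw [real_inner_comm]; exact horth
  have horth'' : ⟪n, a - b⟫ = 0 := by rw [← neg_sub, inner_neg_right, horth', neg_zero]
  have hnn : ⟪n, n⟫ = ‖n‖ ^ 2 := real_inner_self_eq_norm_sq _
  have hbn : ⟪b, n⟫ = ⟪a, n⟫ := by rwa [inner_sub_left, sub_eq_zero] at horth
  have s₁ := JoinedWithin.of_segment (hQ.segment_ray_subset_compl_interior ha.2 hb.1 hτ)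
  have s₂ := JoinedWithin.of_segment (segment_subset_compl_interior (Q := Q) (x := p)
    (y := p + η • n) (sub_ne_zero.2 hab) hy hp_inner.ge
    (by rw [inner_add_left, real_inner_smul_left, horth'', mul_zero, add_zero, hp_inner]))
  have s₃ := JoinedWithin.of_segment (segment_subset_compl_interior (Q := Q) (x := p + η • n)
    (y := q + η • n) (K := ⟪a, n⟫ + η * ‖n‖ ^ 2) hn
    (fun x hx => by have := hη x hx; rw [inner_sub_left] at this; linarith)
    (by simp only [hp, inner_add_left, real_inner_smul_left, inner_sub_left, hbn, hnn]; linarith)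
    (by simp only [hq, inner_add_left, real_inner_smul_left, inner_sub_left, hbn, hnn]; linarith))
  have s₄ := JoinedWithin.of_segment (segment_subset_compl_interior (Q := Q) (x := q + η • n)
    (y := q) (sub_ne_zero.2 hab.symm) hz
    (by rw [inner_add_left, real_inner_smul_left, horth', mul_zero, add_zero, hq_inner])
    hq_inner.ge)
  have s₅ := JoinedWithin.of_segment (S := (interior Q)ᶜ) (x := q) (y := b)
    (by rw [segment_symm]; exact hQ.segment_ray_subset_compl_interior hb.2 ha.1 hσ)
  refine ((((s₁.trans s₂).trans s₃).trans s₄).trans s₅).mono subset_rfl ?_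
  have d₁ : dist a p = τ * ‖b - a‖ := by
    rw [hp, dist_self_add_right, norm_smul, Real.norm_of_nonneg hτ, norm_sub_rev]
  have d₂ : dist p (p + η • n) = η * ‖n‖ := by
    rw [dist_self_add_right, norm_smul, Real.norm_of_nonneg hη0]
  have d₃ : dist (p + η • n) (q + η • n) = (1 + τ + σ) * ‖b - a‖ := by
    have : q - p = (1 + τ + σ) • (b - a) := by rw [hp, hq]; module
    rw [dist_add_right, dist_comm, dist_eq_norm, this, norm_smul,
      Real.norm_of_nonneg (by positivity)]
  have d₄ : dist (q + η • n) q = η * ‖n‖ := by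
    rw [dist_self_add_left, norm_smul, Real.norm_of_nonneg hη0]
  have d₅ : dist q b = σ * ‖b - a‖ := by
    rw [hq, dist_self_add_left, norm_smul, Real.norm_of_nonneg hσ]
  rw [d₁, d₂, d₃, d₄, d₅, ← ENNReal.ofReal_add (by positivity) (by positivity),
    ← ENNReal.ofReal_add (by positivity) (by positivity),
    ← ENNReal.ofReal_add (by positivity) (by positivity),
    ← ENNReal.ofReal_add (by positivity) (by positivity)]
  refine ENNReal.ofReal_le_ofReal ?_
  nlinarith

end ConvexGeometry

theorem JoinedWithin.along_frontier {Q : Set Plane} (hQ : Convex ℝ Q) (hcomp : IsCompact Q)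
    {a b : Plane} (ha : a ∈ Q \ interior Q) (hb : b ∈ Q \ interior Q) :
    JoinedWithin (Q \ interior Q) a b (ENNReal.ofReal (3 * diam Q)) := by
  rcases eq_or_ne a b with rfl | hab
  · exact (JoinedWithin.of_segment (by simpa using ha)).mono subset_rfl
      (ENNReal.ofReal_le_ofReal (by rw [dist_self]; positivity))
  have hne : Q.Nonempty := ⟨a, ha.1⟩
  obtain ⟨n, hn, horth⟩ : ∃ n : Plane, n ≠ 0 ∧ ⟪b - a, n⟫ = 0 := by
    refine ⟨!₂[-(b - a) 1, (b - a) 0], fun h => hab ?_, ?_⟩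
    · have h₀ := congrArg (fun v : Plane => v 0) h
      have h₁ := congrArg (fun v : Plane => v 1) h
      simp at h₀ h₁
      ext i
      fin_cases i <;> simp <;> linarith
    · simp [PiLp.inner_apply, Fin.sum_univ_two]
      ring
  have hn0 : 0 < ‖n‖ := norm_pos_iff.2 hn
  obtain ⟨f, hf, hfix, hmaps⟩ := exists_lipschitz_projection hQ hcomp hne
  suffices h : JoinedWithin (interior Q)ᶜ a b (ENNReal.ofReal (3 * diam Q)) by
    have := h.map hf hmaps
    rwa [hfix a ha.1, hfix b hb.1] at this
  obtain ⟨y, hyQ, hy⟩ := hcomp.exists_isMaxOn hne (f := fun x => ⟪x, n⟫) (by fun_prop)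
  obtain ⟨z, hzQ, hz⟩ := hcomp.exists_isMinOn hne (f := fun x => ⟪x, n⟫) (by fun_prop)
  have hwidth : ⟪y - a, n⟫ / ‖n‖ + ⟪a - z, n⟫ / ‖n‖ ≤ diam Q := by
    have h₁ := real_inner_le_norm (y - z) n
    have h₂ : ‖y - z‖ ≤ diam Q := by
      rw [← dist_eq_norm]
      exact dist_le_diam_of_mem hcomp.isBounded hyQ hzQ
    rw [← add_div, ← inner_add_left, sub_add_sub_cancel, div_le_iff₀ hn0]
    exact h₁.trans (mul_le_mul_of_nonneg_right h₂ hn0.le)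
  have hscale : ∀ r : ℝ, r / ‖n‖ ^ 2 * ‖n‖ = r / ‖n‖ := fun r => by field_simp
  rcases le_total (⟪y - a, n⟫ / ‖n‖) (⟪a - z, n⟫ / ‖n‖) with hle | hle
  · refine JoinedWithin.around_side hQ hcomp ha hb hab hn horth (η := ⟪y - a, n⟫ / ‖n‖ ^ 2)
      (fun x hx => ?_) (by rw [hscale]; linarith)
    rw [div_mul_cancel₀ _ (by positivity), inner_sub_left, inner_sub_left]
    exact sub_le_sub_right (hy hx) _
  · refine JoinedWithin.around_side hQ hcomp ha hb hab (neg_ne_zero.2 hn)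
      (by rw [inner_neg_right, horth, neg_zero]) (η := ⟪a - z, n⟫ / ‖n‖ ^ 2)
      (fun x hx => ?_) (by rw [norm_neg, hscale]; linarith)
    rw [norm_neg, div_mul_cancel₀ _ (by positivity), inner_neg_right, ← inner_neg_left, neg_sub,
      inner_sub_left, inner_sub_left]
    exact sub_le_sub_left (hz hx) _

/-- Rerouting a segment of a convex set around finitely many disjoint convex holes. -/
theorem JoinedWithin.around_holes {ι : Type*} {C : Set Plane} (hC : Convex ℝ C)
    {Q : ι → Set Plane} (hQ : ∀ i, Convex ℝ (Q i)) (hcomp : ∀ i, IsCompact (Q i))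
    (hdisj : Pairwise (Function.onFun Disjoint Q)) (hsub : ∀ i, Q i ⊆ C) {s e : Plane}
    (hs : s ∈ C \ ⋃ i, interior (Q i)) (he : e ∈ C \ ⋃ i, interior (Q i)) (F : Finset ι) :
    JoinedWithin (C \ ⋃ i ∈ F, interior (Q i)) s e
      (ENNReal.ofReal (dist s e + ∑ i ∈ F, 3 * diam (Q i))) := by
  classical
  have hs' : ∀ i, s ∉ interior (Q i) := by simpa using hs.2
  have he' : ∀ i, e ∉ interior (Q i) := by simpa using he.2
  induction F using Finset.induction_on with
  | empty => simpa using JoinedWithin.of_segment (hC.segment_subset hs.1 he.1)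
  | insert j F hj ih =>
    refine (ih.avoid_interior (hcomp j).isClosed (hs' j) (he' j) fun a ha b hb =>
      JoinedWithin.along_frontier (hQ j) (hcomp j) ha hb).mono ?_ ?_
    · rintro x (⟨⟨hxC, hxF⟩, hxj⟩ | ⟨hxQ, hxj⟩)
      · refine ⟨hxC, ?_⟩
        simp only [Finset.mem_insert, iUnion_iUnion_eq_or_left, mem_union, not_or]
        exact ⟨hxj, hxF⟩
      · refine ⟨hsub j hxQ, ?_⟩
        simp only [Finset.mem_insert, iUnion_iUnion_eq_or_left, mem_union, not_or]
        refine ⟨hxj, ?_⟩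
        simp only [mem_iUnion, not_exists]
        intro i hi hxi
        have hij : j ≠ i := fun h => hj (h ▸ hi)
        exact disjoint_left.1 (hdisj hij) hxQ (interior_subset hxi)
    · rw [← ENNReal.ofReal_add (by positivity) (by positivity), Finset.sum_insert hj]
      exact ENNReal.ofReal_le_ofReal (by linarith)

theorem IsConvexPolygon.convex {Q : Set Plane} (hQ : IsConvexPolygon Q) : Convex ℝ Q := by
  obtain ⟨S, -, rfl⟩ := hQ
  exact convex_convexHull ℝ _

theorem IsConvexPolygon.isCompact {Q : Set Plane} (hQ : IsConvexPolygon Q) : IsCompact Q := by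
  obtain ⟨S, -, rfl⟩ := hQ
  exact S.finite_toSet.isCompact_convexHull ℝ

theorem IsConvexPolygon.nonempty {Q : Set Plane} (hQ : IsConvexPolygon Q) : Q.Nonempty := by
  obtain ⟨S, hS, rfl⟩ := hQ
  exact (Finset.coe_nonempty.2 hS).convexHull

/-- Let `h ≥ 1`, `Δ > 0`, and let `P ∈ 𝒞(h)` be a polygonal domain whose holes
satisfy `diam₂(Pᵢ) ≤ Δ·diam₂(P)`. Then from every `s ∈ P` there is a continuous path in `P`
to the outer boundary `frontier P₀` of length at most `(1 + π·h·Δ)·diam₂(P)`. -/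
theorem escape_path_linear_in_holes
    (h : ℕ) (hh : 1 ≤ h) (Δ : ℝ) (hΔ : 0 < Δ)
    (P₀ : Set Plane) (Q : Fin h → Set Plane)
    (hP₀ : IsConvexPolygon P₀)
    (hQ : ∀ i, IsConvexPolygon (Q i))
    (hdisj : Pairwise (Function.onFun Disjoint Q))
    (hsub : ∀ i, Q i ⊆ interior P₀)
    (hsmall : ∀ i, Metric.diam (Q i) ≤ Δ * Metric.diam (P₀ \ ⋃ j, interior (Q j))) :
    ∀ s ∈ (P₀ \ ⋃ i, interior (Q i)),
      ∃ γ : ℝ → Plane,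
        ContinuousOn γ (Set.Icc 0 1) ∧ γ 0 = s ∧ γ 1 ∈ frontier P₀ ∧
        Set.MapsTo γ (Set.Icc 0 1) (P₀ \ ⋃ i, interior (Q i)) ∧
        pathLen γ ≤
          ENNReal.ofReal
            ((1 + Real.pi * h * Δ) * Metric.diam (P₀ \ ⋃ i, interior (Q i))) := by
  intro s hs
  obtain ⟨e, he⟩ : (frontier P₀).Nonempty :=
    nonempty_frontier_iff.2 ⟨hP₀.nonempty, hP₀.isCompact.ne_univ⟩
  have heP : e ∈ P₀ \ ⋃ i, interior (Q i) := by
    refine ⟨hP₀.isCompact.isClosed.frontier_subset he, ?_⟩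
    simp only [mem_iUnion, not_exists]
    exact fun i hi => he.2 (hsub i (interior_subset hi))
  obtain ⟨γ, hc, h0, h1, hmaps, hlen⟩ := JoinedWithin.around_holes hP₀.convex
    (fun i => (hQ i).convex) (fun i => (hQ i).isCompact) hdisj
    (fun i => (hsub i).trans interior_subset) hs heP Finset.univ
  refine ⟨γ, hc, h0, h1 ▸ he, by simpa using hmaps, hlen.trans (ENNReal.ofReal_le_ofReal ?_)⟩
  set D := diam (P₀ \ ⋃ i, interior (Q i))
  have hdist : dist s e ≤ D :=
    dist_le_diam_of_mem (hP₀.isCompact.isBounded.subset sdiff_subset) hs heP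
  have hD : 0 ≤ D := diam_nonneg
  have hsum : ∑ i, 3 * diam (Q i) ≤ h * (3 * (Δ * D)) := by
    refine (Finset.sum_le_sum fun i _ =>
      mul_le_mul_of_nonneg_left (hsmall i) zero_le_three).trans ?_
    simp
  have hpi : 3 * (h * Δ * D) ≤ Real.pi * (h * Δ * D) :=
    mul_le_mul_of_nonneg_right Real.pi_gt_three.le (by positivity)
  linarith
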